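/- Local constancy of the signature: if L1, L2, L3 are continuous paths of Lagrangian subspaces of a real symplectic vector space (E, ω) on an interval [a,b] such that the dimensions dim(L1(t)∩L2(t)), dim(L2(t)∩L3(t)) and dim(L3(t)∩L1(t)) are each constant in t, then the function t ↦ s(L1(t), L2(t), L3(t)) is constant on [a,b]. -/

import Mathlib

open LinearMap (BilinForm)

variable {E : Type*} [NormedAddCommGroup E] [NormedSpace ℝ E]

/-- A subspace is Lagrangian iff it equals its symplectic orthogonal. -/
def IsLagrangian (ω : BilinForm ℝ E) (L : Submodule ℝ E) : Prop :=
  LinearMap.BilinForm.orthogonal ω L = L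

/-- Maximal dimension of a subspace on which the function `Q` is positive away from `0`. -/
noncomputable def posIndex {V : Type*} [AddCommGroup V] [Module ℝ V] (Q : V → ℝ) : ℕ :=
  sSup {d : ℕ | ∃ W : Submodule ℝ V, Module.finrank ℝ W = d ∧ ∀ x ∈ W, x ≠ 0 → 0 < Q x}

/-- The quadratic form `Q(L1,L2,L3)` of a triplet of subspaces,
`Q(x1,x2,x3) = ω(x1,x2) + ω(x2,x3) + ω(x3,x1)`. -/
def tripleQ (ω : BilinForm ℝ E) (L1 L2 L3 : Submodule ℝ E) (v : L1 × L2 × L3) : ℝ :=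
  ω v.1 v.2.1 + ω v.2.1 v.2.2 + ω v.2.2 v.1

/-- The signature `s(L1,L2,L3)` of a triplet of subspaces: the signature (number of positive
squares minus number of negative squares in a diagonalization) of `Q(L1,L2,L3)`. -/
noncomputable def tripleSig (ω : BilinForm ℝ E) (L1 L2 L3 : Submodule ℝ E) : ℤ :=
  (posIndex (tripleQ ω L1 L2 L3) : ℤ) - (posIndex (fun v => - tripleQ ω L1 L2 L3 v) : ℤ)

/-- A continuous path of Lagrangian subspaces of `(E, ω)` on the interval `[a,b]`:  a family
`(L t)` of Lagrangian subspaces such that every `t0 ∈ [a,b]` has a neighbourhood `U` in `[a,b]`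
on which there is a continuous family of idempotent linear maps of `E` with range `L t`. -/
structure IsLagrangianPath (ω : BilinForm ℝ E) (a b : ℝ) (L : ℝ → Submodule ℝ E) : Prop where
  lag : ∀ t ∈ Set.Icc a b, IsLagrangian ω (L t)
  locTriv : ∀ t0 ∈ Set.Icc a b, ∃ U ∈ nhdsWithin t0 (Set.Icc a b), U ⊆ Set.Icc a b ∧
    ∃ P : ℝ → E →L[ℝ] E, ContinuousOn P U ∧
      ∀ t ∈ U, (P t).comp (P t) = P t ∧ LinearMap.range (P t : E →ₗ[ℝ] E) = L t

/-- A jointly continuous two-parameter family `(L s t)`, `s ∈ [0,1]`, `t ∈ [a,b]`, of Lagrangian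
subspaces (a homotopy of paths of Lagrangian subspaces). -/
structure IsLagrangianHomotopy (ω : BilinForm ℝ E) (a b : ℝ)
    (L : ℝ → ℝ → Submodule ℝ E) : Prop where
  lag : ∀ s ∈ Set.Icc (0:ℝ) 1, ∀ t ∈ Set.Icc a b, IsLagrangian ω (L s t)
  locTriv : ∀ p ∈ Set.Icc (0:ℝ) 1 ×ˢ Set.Icc a b,
    ∃ U ∈ nhdsWithin p (Set.Icc (0:ℝ) 1 ×ˢ Set.Icc a b),
      U ⊆ Set.Icc (0:ℝ) 1 ×ˢ Set.Icc a b ∧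
      ∃ P : ℝ × ℝ → E →L[ℝ] E, ContinuousOn P U ∧
        ∀ q ∈ U, (P q).comp (P q) = P q ∧ LinearMap.range (P q : E →ₗ[ℝ] E) = L q.1 q.2

/-- Admissible data for a pair of paths of Lagrangian subspaces on `[a,b]`:  a partition
`a = t_0 ≤ t_1 ≤ … ≤ t_k = b` together with Lagrangian subspaces `M_1, …, M_k` such that
`M_ν ∩ L_i(t) = 0` for all `t ∈ [t_{ν-1}, t_ν]`, `i = 1,2`.  (Here `M (ν+1)` plays the role
of `M_{ν+1}` for `0 ≤ ν < k`.) -/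
structure AdmissibleData (ω : BilinForm ℝ E) (a b : ℝ) (L1 L2 : ℝ → Submodule ℝ E) where
  k : ℕ
  kpos : 0 < k
  t : ℕ → ℝ
  M : ℕ → Submodule ℝ E
  ht0 : t 0 = a
  htk : t k = b
  hmono : ∀ ν < k, t ν ≤ t (ν + 1)
  hlag : ∀ ν < k, IsLagrangian ω (M (ν + 1))
  htrans1 : ∀ ν < k, ∀ s ∈ Set.Icc (t ν) (t (ν + 1)), M (ν + 1) ⊓ L1 s = ⊥
  htrans2 : ∀ ν < k, ∀ s ∈ Set.Icc (t ν) (t (ν + 1)), M (ν + 1) ⊓ L2 s = ⊥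

/-- The expression `(1/2) Σ_ν ( s(L1(t_{ν-1}), L2(t_{ν-1}), M_ν) − s(L1(t_ν), L2(t_ν), M_ν) )`
computed from admissible data; by well-definedness this is the intersection number `[L1 : L2]`. -/
noncomputable def dataSum {ω : BilinForm ℝ E} {a b : ℝ} {L1 L2 : ℝ → Submodule ℝ E}
    (D : AdmissibleData ω a b L1 L2) : ℝ :=
  (1 / 2 : ℝ) * ∑ ν ∈ Finset.range D.k,
    ((tripleSig ω (L1 (D.t ν)) (L2 (D.t ν)) (D.M (ν + 1)) : ℝ)
      - (tripleSig ω (L1 (D.t (ν + 1))) (L2 (D.t (ν + 1))) (D.M (ν + 1)) : ℝ))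

/-- A continuous path of symplectic automorphisms of `(E, ω)` on `[a,b]`. -/
structure IsSymplecticPath (ω : BilinForm ℝ E) (a b : ℝ) (A : ℝ → E →L[ℝ] E) : Prop where
  bij : ∀ t ∈ Set.Icc a b, Function.Bijective (A t)
  symp : ∀ t ∈ Set.Icc a b, ∀ x y, ω (A t x) (A t y) = ω x y
  cont : ContinuousOn A (Set.Icc a b)

/-- The symplectic form of `E × E⁻`: `((x1,x2),(y1,y2)) ↦ ω(x1,y1) − ω(x2,y2)`. -/
noncomputable def prodNegForm (ω : BilinForm ℝ E) : BilinForm ℝ (E × E) :=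
  LinearMap.mk₂ ℝ (fun x y => ω x.1 y.1 - ω x.2 y.2)
    (fun x x' y => by simp only [Prod.fst_add, Prod.snd_add, map_add, LinearMap.add_apply]; ring)
    (fun c x y => by
      simp only [Prod.smul_fst, Prod.smul_snd, map_smul, LinearMap.smul_apply, smul_eq_mul]; ring)
    (fun x y y' => by simp only [Prod.fst_add, Prod.snd_add, map_add]; ring)
    (fun c x y => by simp only [Prod.smul_fst, Prod.smul_snd, map_smul, smul_eq_mul]; ring)

/-- The graph `Γ_A = {(A x, x)}` of an endomorphism, as a subspace of `E × E`. -/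
def graphSub (A : E →L[ℝ] E) : Submodule ℝ (E × E) :=
  LinearMap.range ((A : E →ₗ[ℝ] E).prod LinearMap.id)

/-- The diagonal `Δ = {(x, x)}` in `E × E`. -/
def diagSub : Submodule ℝ (E × E) :=
  LinearMap.range ((LinearMap.id : E →ₗ[ℝ] E).prod LinearMap.id)

open Filter Topology

/-- The bilinear form on `L1 × L2 × L3` whose diagonal is `tripleQ`. -/
noncomputable def tripleBilin (ω : BilinForm ℝ E) (L1 L2 L3 : Submodule ℝ E) :
    BilinForm ℝ (L1 × L2 × L3) :=
  let p1 : L1 × L2 × L3 →ₗ[ℝ] E := L1.subtype ∘ₗ LinearMap.fst ℝ _ _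
  let p2 : L1 × L2 × L3 →ₗ[ℝ] E := L2.subtype ∘ₗ LinearMap.fst ℝ _ _ ∘ₗ LinearMap.snd ℝ _ _
  let p3 : L1 × L2 × L3 →ₗ[ℝ] E := L3.subtype ∘ₗ LinearMap.snd ℝ _ _ ∘ₗ LinearMap.snd ℝ _ _
  ω.compl₁₂ p1 p2 + ω.compl₁₂ p2 p3 + ω.compl₁₂ p3 p1

/-- `tripleQ` as a bundled quadratic form. -/
noncomputable def tripleForm (ω : BilinForm ℝ E) (L1 L2 L3 : Submodule ℝ E) :
    QuadraticForm ℝ (L1 × L2 × L3) :=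
  LinearMap.BilinMap.toQuadraticMap (tripleBilin ω L1 L2 L3)

lemma tripleForm_apply (ω : BilinForm ℝ E) (L1 L2 L3 : Submodule ℝ E) (v : L1 × L2 × L3) :
    tripleForm ω L1 L2 L3 v = ω v.1 v.2.1 + ω v.2.1 v.2.2 + ω v.2.2 v.1 := rfl

lemma tripleForm_neg (ω : BilinForm ℝ E) (L1 L2 L3 : Submodule ℝ E) :
    tripleForm (-ω) L1 L2 L3 = -tripleForm ω L1 L2 L3 := by
  ext v
  simp only [neg_apply, tripleForm_apply, LinearMap.neg_apply]
  ring

lemma posIndex_eq_sigPos {V : Type*} [AddCommGroup V] [Module ℝ V] [FiniteDimensional ℝ V]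
    (Q : QuadraticForm ℝ V) : posIndex Q = sigPos Q := by
  rw [← (sigPos_isGreatest Q).csSup_eq, posIndex]
  congr! 5 with d W
  refine and_congr_right fun _ => ⟨?_, ?_⟩
  · rintro h ⟨x, hx⟩ hx0
    exact h x hx (by simpa using hx0)
  · intro h x hx hx0
    exact h ⟨x, hx⟩ (by simpa using hx0)

lemma tripleSig_eq [FiniteDimensional ℝ E] (ω : BilinForm ℝ E) (L1 L2 L3 : Submodule ℝ E) :
    tripleSig ω L1 L2 L3 =
      (sigPos (tripleForm ω L1 L2 L3) : ℤ) -
        (sigPos (tripleForm (-ω) L1 L2 L3) : ℤ) := by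
  rw [tripleSig, ← posIndex_eq_sigPos, ← posIndex_eq_sigPos, tripleForm_neg]
  rfl

lemma IsLagrangian.mem_iff {ω : BilinForm ℝ E} {L : Submodule ℝ E} (h : IsLagrangian ω L)
    {x : E} : x ∈ L ↔ ∀ y ∈ L, ω y x = 0 := by
  conv_lhs => rw [← h]
  rfl

lemma IsLagrangian.two_mul_finrank [FiniteDimensional ℝ E] {ω : BilinForm ℝ E}
    (hnd : LinearMap.BilinForm.Nondegenerate ω) {L : Submodule ℝ E} (h : IsLagrangian ω L) :
    2 * Module.finrank ℝ L = Module.finrank ℝ E := by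
  have := LinearMap.BilinForm.finrank_orthogonal hnd L
  rw [h] at this
  have := Submodule.finrank_le L
  omega

/-- The parametrization `(u, v, w) ↦ (u + w, u + v, v + w)` of the radical of `tripleForm`. -/
def radicalParam (L1 L2 L3 : Submodule ℝ E) :
    (↥(L1 ⊓ L2) × ↥(L2 ⊓ L3) × ↥(L3 ⊓ L1)) →ₗ[ℝ] L1 × L2 × L3 where
  toFun p := (⟨p.1 + p.2.2, L1.add_mem p.1.2.1 p.2.2.2.2⟩,
    ⟨p.1 + p.2.1, L2.add_mem p.1.2.2 p.2.1.2.1⟩,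
    ⟨p.2.1 + p.2.2, L3.add_mem p.2.1.2.2 p.2.2.2.1⟩)
  map_add' p q := by
    ext <;> simp <;> abel
  map_smul' c p := by
    ext <;> simp

lemma radicalParam_injective (L1 L2 L3 : Submodule ℝ E) :
    Function.Injective (radicalParam L1 L2 L3) := by
  rw [injective_iff_map_eq_zero]
  rintro ⟨u, v, w⟩ h
  simp only [radicalParam, LinearMap.coe_mk, AddHom.coe_mk, Prod.mk_eq_zero,
    Submodule.mk_eq_zero] at h
  obtain ⟨h1, h2, h3⟩ := h
  have hu : (2 : ℝ) • (u : E) = 0 := by linear_combination (norm := module) (1 : ℝ) • h1 + (1 : ℝ) • h2 - (1 : ℝ) • h3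
  have hv : (2 : ℝ) • (v : E) = 0 := by linear_combination (norm := module) (1 : ℝ) • h2 + (1 : ℝ) • h3 - (1 : ℝ) • h1
  have hw : (2 : ℝ) • (w : E) = 0 := by linear_combination (norm := module) (1 : ℝ) • h3 + (1 : ℝ) • h1 - (1 : ℝ) • h2
  simpa using And.intro hu (And.intro hv hw)

lemma radical_tripleForm {ω : BilinForm ℝ E} (halt : LinearMap.IsAlt ω)
    {L1 L2 L3 : Submodule ℝ E} (h1 : IsLagrangian ω L1) (h2 : IsLagrangian ω L2)
    (h3 : IsLagrangian ω L3) :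
    (tripleForm ω L1 L2 L3).radical = LinearMap.range (radicalParam L1 L2 L3) := by
  have hneg : ∀ x y, ω x y = - ω y x := fun x y => (halt.neg y x).symm
  ext ⟨⟨x, hx⟩, ⟨y, hy⟩, ⟨z, hz⟩⟩
  rw [QuadraticMap.mem_radical_iff']
  constructor
  · rintro ⟨h0, h⟩
    simp only [tripleForm_apply] at h0 h
    have k1 : y - z ∈ L1 := h1.mem_iff.2 fun u hu => by
      have := h (⟨u, hu⟩, 0, 0)
      simp at this
      simp only [map_sub]
      linarith [hneg z u]
    have k2 : z - x ∈ L2 := h2.mem_iff.2 fun u hu => by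
      have := h (0, ⟨u, hu⟩, 0)
      simp at this
      simp only [map_sub]
      linarith [hneg x u]
    have k3 : x - y ∈ L3 := h3.mem_iff.2 fun u hu => by
      have := h (0, 0, ⟨u, hu⟩)
      simp at this
      simp only [map_sub]
      linarith [hneg y u]
    have hu1 : x + y - z ∈ L1 := by convert L1.add_mem hx k1 using 1; abel
    have hu2 : x + y - z ∈ L2 := by convert L2.sub_mem hy k2 using 1; abel
    have hv2 : y + z - x ∈ L2 := by convert L2.add_mem hy k2 using 1; abel
    have hv3 : y + z - x ∈ L3 := by convert L3.sub_mem hz k3 using 1; abel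
    have hw3 : z + x - y ∈ L3 := by convert L3.add_mem hz k3 using 1; abel
    have hw1 : z + x - y ∈ L1 := by convert L1.sub_mem hx k1 using 1; abel
    refine ⟨((1 / 2 : ℝ) • ⟨x + y - z, hu1, hu2⟩, (1 / 2 : ℝ) • ⟨y + z - x, hv2, hv3⟩,
      (1 / 2 : ℝ) • ⟨z + x - y, hw3, hw1⟩), ?_⟩
    ext <;> simp [radicalParam] <;> module
  · rintro ⟨⟨⟨u, hu1, hu2⟩, ⟨v, hv2, hv3⟩, ⟨w, hw3, hw1⟩⟩, h⟩
    simp only [radicalParam, LinearMap.coe_mk, AddHom.coe_mk, Prod.mk.injEq,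
      Subtype.mk.injEq] at h
    obtain ⟨rfl, rfl, rfl⟩ := h
    have z1 : ∀ p ∈ L1, ∀ q ∈ L1, ω p q = 0 := fun p hp q hq => h1.mem_iff.1 hq p hp
    have z2 : ∀ p ∈ L2, ∀ q ∈ L2, ω p q = 0 := fun p hp q hq => h2.mem_iff.1 hq p hp
    have z3 : ∀ p ∈ L3, ∀ q ∈ L3, ω p q = 0 := fun p hp q hq => h3.mem_iff.1 hq p hp
    constructor
    · simp only [tripleForm_apply, map_add, LinearMap.add_apply]
      linarith [z1 u hu1 u hu1, z2 u hu2 v hv2, z1 w hw1 u hu1, hneg w v, z2 v hv2 v hv2,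
        z3 v hv3 w hw3, z3 w hw3 v hv3, z2 v hv2 u hu2, z1 u hu1 w hw1, z3 w hw3 w hw3]
    · rintro ⟨⟨p, hp⟩, ⟨q, hq⟩, ⟨r, hr⟩⟩
      simp only [tripleForm_apply, map_add, LinearMap.add_apply, Prod.mk_add_mk,
        Submodule.coe_add]
      linarith [z1 u hu1 u hu1, z2 u hu2 v hv2, z1 w hw1 u hu1, hneg w v, z2 v hv2 v hv2,
        z3 v hv3 w hw3, z3 w hw3 v hv3, z2 v hv2 u hu2, z1 u hu1 w hw1, z3 w hw3 w hw3,
        z1 p hp u hu1, z1 p hp w hw1, z2 q hq u hu2, z2 q hq v hv2, z3 r hr v hv3,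
        z3 r hr w hw3, z1 u hu1 p hp, z1 w hw1 p hp, z2 u hu2 q hq, z2 v hv2 q hq,
        z3 v hv3 r hr, z3 w hw3 r hr, hneg p v, hneg q w, hneg r u]

lemma sigPos_add_sigPos_tripleForm [FiniteDimensional ℝ E] {ω : BilinForm ℝ E}
    (halt : LinearMap.IsAlt ω) {L1 L2 L3 : Submodule ℝ E} (h1 : IsLagrangian ω L1)
    (h2 : IsLagrangian ω L2) (h3 : IsLagrangian ω L3) :
    sigPos (tripleForm ω L1 L2 L3) + sigPos (tripleForm (-ω) L1 L2 L3) +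
      (Module.finrank ℝ ↥(L1 ⊓ L2) + Module.finrank ℝ ↥(L2 ⊓ L3) + Module.finrank ℝ ↥(L3 ⊓ L1)) =
    Module.finrank ℝ L1 + Module.finrank ℝ L2 + Module.finrank ℝ L3 := by
  have h := QuadraticForm.sigPos_add_sigNeg_add_radical (Q := tripleForm ω L1 L2 L3)
  rw [radical_tripleForm halt h1 h2 h3,
    LinearMap.finrank_range_of_inj (radicalParam_injective L1 L2 L3)] at h
  simp only [Module.finrank_prod] at h
  rw [tripleForm_neg, sigPos_neg]
  omega

lemma continuous_bilinForm_apply [FiniteDimensional ℝ E] (ω : BilinForm ℝ E) :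
    Continuous fun p : E × E => ω p.1 p.2 := by
  let ω' : E →L[ℝ] E →L[ℝ] ℝ :=
    LinearMap.toContinuousLinearMap
      ((LinearMap.toContinuousLinearMap : (E →ₗ[ℝ] ℝ) ≃ₗ[ℝ] E →L[ℝ] ℝ).toLinearMap ∘ₗ ω)
  have : Continuous fun p : E × E => ω' p.1 p.2 := by fun_prop
  exact this

/-- Lower semicontinuity of the positive index of inertia of `tripleForm`. -/
lemma eventually_sigPos_tripleForm_le [FiniteDimensional ℝ E] (ω : BilinForm ℝ E) {ι : Type*}
    {l : Filter ι} {L1 L2 L3 : ι → Submodule ℝ E} {M1 M2 M3 : Submodule ℝ E}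
    {P1 P2 P3 : ι → E →L[ℝ] E} {A1 A2 A3 : E →L[ℝ] E}
    (hP1 : Tendsto P1 l (𝓝 A1)) (hP2 : Tendsto P2 l (𝓝 A2)) (hP3 : Tendsto P3 l (𝓝 A3))
    (hA1 : ∀ x ∈ M1, A1 x = x) (hA2 : ∀ x ∈ M2, A2 x = x) (hA3 : ∀ x ∈ M3, A3 x = x)
    (hL1 : ∀ᶠ t in l, ∀ x, P1 t x ∈ L1 t) (hL2 : ∀ᶠ t in l, ∀ x, P2 t x ∈ L2 t)
    (hL3 : ∀ᶠ t in l, ∀ x, P3 t x ∈ L3 t) :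
    ∀ᶠ t in l, sigPos (tripleForm ω M1 M2 M3) ≤
      sigPos (tripleForm ω (L1 t) (L2 t) (L3 t)) := by
  obtain ⟨W, hWd, hW⟩ := exists_finrank_eq_sigPos_and_posDef (tripleForm ω M1 M2 M3)
  let f : (E →L[ℝ] E) × (E →L[ℝ] E) × (E →L[ℝ] E) → W → ℝ := fun A x =>
    ω (A.1 x.1.1) (A.2.1 x.1.2.1) + ω (A.2.1 x.1.2.1) (A.2.2 x.1.2.2) +
      ω (A.2.2 x.1.2.2) (A.1 x.1.1)
  have hω := continuous_bilinForm_apply ω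
  have hf : Continuous fun p : ((E →L[ℝ] E) × (E →L[ℝ] E) × (E →L[ℝ] E)) × W => f p.1 p.2 := by
    refine ((hω.comp (Continuous.prodMk ?_ ?_)).add (hω.comp (Continuous.prodMk ?_ ?_))).add
      (hω.comp (Continuous.prodMk ?_ ?_)) <;> fun_prop
  have hev : ∀ᶠ A in 𝓝 (A1, A2, A3), ∀ x ∈ Metric.sphere (0 : W) 1, 0 < f A x := by
    refine (isCompact_sphere (0 : W) 1).eventually_forall_of_forall_eventually fun x hx => ?_
    refine hf.continuousAt.eventually (lt_mem_nhds ?_)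
    have := hW x (ne_zero_of_mem_unit_sphere ⟨x, hx⟩)
    simpa [f, tripleForm_apply, hA1 _ x.1.1.2, hA2 _ x.1.2.1.2, hA3 _ x.1.2.2.2] using this
  have hlim : Tendsto (fun t => (P1 t, P2 t, P3 t)) l (𝓝 (A1, A2, A3)) :=
    hP1.prodMk_nhds (hP2.prodMk_nhds hP3)
  filter_upwards [hlim.eventually hev, hL1, hL2, hL3] with t ht h1 h2 h3
  have hpos : ∀ x : W, x ≠ 0 → 0 < f (P1 t, P2 t, P3 t) x := by
    intro x hx
    have hn : 0 < ‖x‖ := norm_pos_iff.2 hx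
    have := ht (‖x‖⁻¹ • x) (by
      rw [mem_sphere_zero_iff_norm, norm_smul, norm_inv, norm_norm, inv_mul_cancel₀ hn.ne'])
    have h' : f (P1 t, P2 t, P3 t) (‖x‖⁻¹ • x) = ‖x‖⁻¹ ^ 2 * f (P1 t, P2 t, P3 t) x := by
      simp [f]
      ring
    rw [h'] at this
    exact pos_of_mul_pos_right this (by positivity)
  let T : W →ₗ[ℝ] L1 t × L2 t × L3 t :=
    (((P1 t : E →ₗ[ℝ] E).codRestrict (L1 t) h1 ∘ₗ M1.subtype).prodMap
      (((P2 t : E →ₗ[ℝ] E).codRestrict (L2 t) h2 ∘ₗ M2.subtype).prodMap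
        ((P3 t : E →ₗ[ℝ] E).codRestrict (L3 t) h3 ∘ₗ M3.subtype))) ∘ₗ W.subtype
  have hT : ∀ x, tripleForm ω (L1 t) (L2 t) (L3 t) (T x) = f (P1 t, P2 t, P3 t) x := fun x => rfl
  have hTinj : Function.Injective T := by
    rw [injective_iff_map_eq_zero]
    intro x hx
    by_contra hx0
    have := hpos x hx0
    rw [← hT, hx, map_zero] at this
    exact this.false
  rw [← hWd, ← LinearMap.finrank_range_of_inj hTinj]
  refine le_sigPos_of_posDef _ ?_
  rintro ⟨_, x, rfl⟩ hx
  have hx0 : x ≠ 0 := by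
    rintro rfl
    exact hx (by simp)
  exact (hpos x hx0).trans_eq (hT x).symm

lemma IsLagrangianPath.exists_tendsto {ω : BilinForm ℝ E} {a b : ℝ} {L : ℝ → Submodule ℝ E}
    (h : IsLagrangianPath ω a b L) {t0 : ℝ} (ht0 : t0 ∈ Set.Icc a b) :
    ∃ P : ℝ → E →L[ℝ] E, Tendsto P (𝓝[Set.Icc a b] t0) (𝓝 (P t0)) ∧
      (∀ x ∈ L t0, P t0 x = x) ∧ ∀ᶠ t in 𝓝[Set.Icc a b] t0, ∀ x, P t x ∈ L t := by
  obtain ⟨U, hU, -, P, hP, hPU⟩ := h.locTriv t0 ht0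
  have htU := mem_of_mem_nhdsWithin ht0 hU
  refine ⟨P, (hP t0 htU).mono_of_mem_nhdsWithin hU, ?_, ?_⟩
  · intro x hx
    rw [← (hPU t0 htU).2] at hx
    obtain ⟨y, rfl⟩ := hx
    exact DFunLike.congr_fun (hPU t0 htU).1 y
  · filter_upwards [hU] with t ht x
    rw [← (hPU t ht).2]
    exact ⟨x, rfl⟩

/-- the signature is locally constant on triplets with constant dimensions of the
pairwise intersections:  for continuous paths of Lagrangian subspaces with constant
`dim(L1(t)∩L2(t))`, `dim(L2(t)∩L3(t))`, `dim(L3(t)∩L1(t))`, the signature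
`s(L1(t),L2(t),L3(t))` is constant on `[a,b]`. -/
theorem signature_locally_constant [FiniteDimensional ℝ E]
    (ω : BilinForm ℝ E) (halt : LinearMap.IsAlt ω)
    (hnd : LinearMap.BilinForm.Nondegenerate ω)
    (a b : ℝ) (hab : a ≤ b)
    (L1 L2 L3 : ℝ → Submodule ℝ E)
    (h1 : IsLagrangianPath ω a b L1) (h2 : IsLagrangianPath ω a b L2)
    (h3 : IsLagrangianPath ω a b L3)
    (h12 : ∀ t ∈ Set.Icc a b, ∀ t' ∈ Set.Icc a b,
      Module.finrank ℝ ↥(L1 t ⊓ L2 t) = Module.finrank ℝ ↥(L1 t' ⊓ L2 t'))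
    (h23 : ∀ t ∈ Set.Icc a b, ∀ t' ∈ Set.Icc a b,
      Module.finrank ℝ ↥(L2 t ⊓ L3 t) = Module.finrank ℝ ↥(L2 t' ⊓ L3 t'))
    (h31 : ∀ t ∈ Set.Icc a b, ∀ t' ∈ Set.Icc a b,
      Module.finrank ℝ ↥(L3 t ⊓ L1 t) = Module.finrank ℝ ↥(L3 t' ⊓ L1 t')) :
    ∀ t ∈ Set.Icc a b, ∀ t' ∈ Set.Icc a b,
      tripleSig ω (L1 t) (L2 t) (L3 t) = tripleSig ω (L1 t') (L2 t') (L3 t') := by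
  have hloc : ∀ t0 ∈ Set.Icc a b, ∀ᶠ t in 𝓝[Set.Icc a b] t0,
      tripleSig ω (L1 t) (L2 t) (L3 t) = tripleSig ω (L1 t0) (L2 t0) (L3 t0) := by
    intro t0 ht0
    obtain ⟨P1, hP1, hA1, hL1⟩ := h1.exists_tendsto ht0
    obtain ⟨P2, hP2, hA2, hL2⟩ := h2.exists_tendsto ht0
    obtain ⟨P3, hP3, hA3, hL3⟩ := h3.exists_tendsto ht0
    filter_upwards [self_mem_nhdsWithin,
      eventually_sigPos_tripleForm_le ω hP1 hP2 hP3 hA1 hA2 hA3 hL1 hL2 hL3,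
      eventually_sigPos_tripleForm_le (-ω) hP1 hP2 hP3 hA1 hA2 hA3 hL1 hL2 hL3] with t ht hp hn
    have e := sigPos_add_sigPos_tripleForm halt (h1.lag t ht) (h2.lag t ht) (h3.lag t ht)
    have e0 := sigPos_add_sigPos_tripleForm halt (h1.lag t0 ht0) (h2.lag t0 ht0) (h3.lag t0 ht0)
    rw [tripleSig_eq, tripleSig_eq]
    have d1 := (h1.lag t ht).two_mul_finrank hnd
    have d2 := (h2.lag t ht).two_mul_finrank hnd
    have d3 := (h3.lag t ht).two_mul_finrank hnd
    have d1' := (h1.lag t0 ht0).two_mul_finrank hnd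
    have d2' := (h2.lag t0 ht0).two_mul_finrank hnd
    have d3' := (h3.lag t0 ht0).two_mul_finrank hnd
    have c12 := h12 t ht t0 ht0
    have c23 := h23 t ht t0 ht0
    have c31 := h31 t ht t0 ht0
    omega
  intro t ht t' ht'
  refine isPreconnected_Icc.constant (f := fun t => tripleSig ω (L1 t) (L2 t) (L3 t))
    (fun t0 ht0 => ?_) ht ht'
  exact tendsto_nhds_of_eventually_eq (hloc t0 ht0)
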